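/- arXiv:1305.5121 — 4 statements merged into one kernel-verified Lean document; each statement's English description precedes it below -/
import Mathlib

section
/- Let A = (L/F, σ, a) be a nonassociative cyclic algebra of degree n. If the elements 1, a, a², …, a^{n−1} are linearly independent over F, then A is a division algebra, i.e. for all x, y ∈ A, xy = 0 implies x = 0 or y = 0. -/
noncomputable section

/-- Multiplication of the nonassociative cyclic algebra `(L/F, σ, a)` of degree `n`,
realised on the `F`-vector space `Fin n → L` (coordinates w.r.t. the basis `1, z, …, z^(n-1)`):
`(l z^i)(m z^j) = l σ^i(m) z^(i+j)` if `i + j < n` and `l σ^i(m) a z^(i+j-n)` if `i + j ≥ n`. -/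
def cycMul {F L : Type*} [Field F] [Field L] [Algebra F L] (n : ℕ)
    (σ : L ≃ₐ[F] L) (a : L) (x y : Fin n → L) : Fin n → L :=
  fun k => ∑ i : Fin n, ∑ j : Fin n,
    if (i : ℕ) + (j : ℕ) = (k : ℕ) then x i * (σ ^ (i : ℕ)) (y j)
    else if (i : ℕ) + (j : ℕ) = (k : ℕ) + n then x i * (σ ^ (i : ℕ)) (y j) * a
    else 0

open Polynomial

/-- The matrix, over `L[T]` with `T = z ^ n`, of left multiplication by `∑ i, x i * z ^ i` on the
skew polynomial ring `L[z; σ]`, viewed as a right `L[T]`-module with basis `1, z, …, z ^ (n - 1)`. -/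
def leftMulMatrix {F L : Type*} [Field F] [Field L] [Algebra F L] {n : ℕ}
    (σ : L ≃ₐ[F] L) (x : Fin n → L) : Matrix (Fin n) (Fin n) L[X] :=
  Matrix.of fun k j => C ((σ⁻¹ ^ (k : ℕ)) (x (k - j))) * if k < j then X else 1

/-- A conjugate of `leftMulMatrix σ x` after the substitution `T = z ^ n`, with entries graded by
`k - j`. -/
def gradedLeftMulMatrix {F L : Type*} [Field F] [Field L] [Algebra F L] {n : ℕ}
    (σ : L ≃ₐ[F] L) (x : Fin n → L) : Matrix (Fin n) (Fin n) L[X] :=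
  Matrix.of fun k j => C ((σ⁻¹ ^ (k : ℕ)) (x (k - j))) * X ^ ((k - j : Fin n) : ℕ)

theorem Fin.val_sub_eq_ite {n : ℕ} (k j : Fin n) :
    ((k - j : Fin n) : ℕ) = if (j : ℕ) ≤ k then (k : ℕ) - j else n + k - j := by
  split_ifs with h
  · exact Fin.coe_sub_iff_le.2 h
  · exact Fin.coe_sub_iff_lt.2 (not_le.1 h)

theorem pow_fin_val_add {G : Type*} [Monoid G] {n : ℕ} {g : G} (hg : g ^ n = 1) (i j : Fin n) :
    g ^ ((i + j : Fin n) : ℕ) = g ^ (i : ℕ) * g ^ (j : ℕ) := by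
  rw [Fin.val_add, ← pow_eq_pow_mod _ hg, pow_add]

section

variable {F L : Type*} [Field F] [Field L] [Algebra F L] {n : ℕ}

theorem cycMul_apply (σ : L ≃ₐ[F] L) (a : L) (x y : Fin n → L) (k : Fin n) :
    cycMul n σ a x y k =
      ∑ i : Fin n, x i * (σ ^ (i : ℕ)) (y (k - i)) * if k < i then a else 1 := by
  refine Finset.sum_congr rfl fun i _ => ?_
  have hv := Fin.val_sub_eq_ite k i
  rw [Finset.sum_eq_single (k - i)]
  · by_cases h : (i : ℕ) ≤ k
    · rw [if_pos h] at hv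
      rw [if_pos (by omega), if_neg (by rw [Fin.lt_def]; omega), mul_one]
    · rw [if_neg h] at hv
      rw [if_neg (by omega), if_pos (by omega), if_pos (by rw [Fin.lt_def]; omega)]
  · intro j _ hj
    have hj' : (j : ℕ) ≠ ((k - i : Fin n) : ℕ) := fun h => hj (Fin.ext h)
    split_ifs at hv <;> rw [if_neg (by omega), if_neg (by omega)]
  · simp

/-- Modulo `T - a`, the first row of the product of two left multiplication matrices consists of
multiples of the coordinates of the product in the nonassociative cyclic algebra. -/
theorem eval_leftMulMatrix_mul_zero_row [NeZero n] {σ : L ≃ₐ[F] L} (hσ : σ ^ n = 1) (a : L)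
    (x y : Fin n → L) (j : Fin n) :
    ((evalRingHom a).mapMatrix (leftMulMatrix σ x) *
      (evalRingHom a).mapMatrix (leftMulMatrix σ y)) 0 j =
      (if j = 0 then 1 else a) * cycMul n σ a x y (-j) := by
  rw [cycMul_apply, Matrix.mul_apply, Finset.mul_sum, ← Equiv.sum_comp (Equiv.neg (Fin n))]
  refine Finset.sum_congr rfl fun i _ => ?_
  have hpow : σ⁻¹ ^ ((-i : Fin n) : ℕ) = σ ^ (i : ℕ) := by
    have h := pow_fin_val_add hσ (-i) i
    rw [neg_add_cancel, Fin.val_zero, pow_zero] at h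
    rw [inv_pow]
    exact inv_eq_of_mul_eq_one_right h.symm
  have hw : (if (0 : Fin n) < -i then a else 1) * (if -i < j then a else 1) =
      (if j = 0 then 1 else a) * (if -j < i then a else 1) := by
    have hneg (l : Fin n) : (l : ℕ) = 0 ∧ ((-l : Fin n) : ℕ) = 0 ∨
        (l : ℕ) ≠ 0 ∧ ((-l : Fin n) : ℕ) = n - l := by
      rw [Fin.val_neg]
      split_ifs with h <;> simp [h]
    have hi := i.isLt
    have hj := j.isLt
    simp only [Fin.lt_def, Fin.ext_iff, Fin.val_zero]
    rcases hneg i with h₁ | h₁ <;> rcases hneg j with h₂ | h₂ <;> split_ifs <;>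
      first | omega | simp
  simp only [leftMulMatrix, RingHom.mapMatrix_apply, Matrix.map_apply, Matrix.of_apply,
    Equiv.neg_apply, coe_evalRingHom, eval_mul, eval_C, apply_ite (eval a), eval_X, eval_one, hpow,
    Fin.val_zero, pow_zero, AlgEquiv.one_apply, zero_sub, neg_neg]
  rw [neg_sub_left, add_comm, ← neg_sub_left]
  linear_combination (x i * (σ ^ (i : ℕ)) (y (-j - i))) * hw

theorem natDegree_det_leftMulMatrix_lt [NeZero n] (σ : L ≃ₐ[F] L) (x : Fin n → L) :
    (leftMulMatrix σ x).det.natDegree < n := by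
  have hn : 0 < n := Nat.pos_of_neZero n
  refine lt_of_le_of_lt ?_ (Nat.sub_lt hn one_pos)
  rw [Matrix.det_apply]
  refine natDegree_sum_le_of_forall_le _ _ fun π _ => ?_
  refine (natDegree_smul_le _ _).trans ((natDegree_prod_le _ _).trans ?_)
  have h (j : Fin n) : (leftMulMatrix σ x (π j) j).natDegree ≤ if j = 0 then 0 else 1 := by
    rw [leftMulMatrix, Matrix.of_apply]
    refine (natDegree_C_mul_le _ _).trans ?_
    split_ifs with h₁ h₂ <;> simp_all
  refine (Finset.sum_le_sum fun j _ => h j).trans ?_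
  simp [Finset.sum_ite, Finset.filter_ne']

theorem expand_det_leftMulMatrix (σ : L ≃ₐ[F] L) (x : Fin n → L) :
    expand L n (leftMulMatrix σ x).det = (gradedLeftMulMatrix σ x).det := by
  have h : Matrix.diagonal (fun k : Fin n => (X : L[X]) ^ (k : ℕ)) *
      (expand L n).mapMatrix (leftMulMatrix σ x) =
      gradedLeftMulMatrix σ x * Matrix.diagonal (fun k : Fin n => (X : L[X]) ^ (k : ℕ)) := by
    ext1 k j
    have hv := Fin.val_sub_eq_ite k j
    have he : (X : L[X]) ^ (k : ℕ) * (if k < j then X ^ n else 1) =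
        X ^ ((k - j : Fin n) : ℕ) * X ^ (j : ℕ) := by
      simp only [Fin.lt_def]
      split_ifs at hv ⊢
      · omega
      · rw [← pow_add, ← pow_add]; congr 1; omega
      · rw [mul_one, ← pow_add]; congr 1; omega
      · omega
    simp only [Matrix.diagonal_mul, Matrix.mul_diagonal, AlgHom.mapMatrix_apply, Matrix.map_apply,
      leftMulMatrix, gradedLeftMulMatrix, Matrix.of_apply, map_mul, expand_C,
      apply_ite (expand L n), expand_X, map_one]
    linear_combination C ((σ⁻¹ ^ (k : ℕ)) (x (k - j))) * he
  have hd := congr_arg Matrix.det h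
  rw [Matrix.det_mul, Matrix.det_mul, mul_comm, Matrix.det_diagonal, ← AlgHom.map_det] at hd
  exact mul_right_cancel₀ (Finset.prod_ne_zero_iff.2 fun k _ => pow_ne_zero _ X_ne_zero) hd

theorem map_det_gradedLeftMulMatrix [NeZero n] {σ : L ≃ₐ[F] L} (hσ : σ ^ n = 1)
    (x : Fin n → L) :
    mapRingHom (σ : L →+* L) (gradedLeftMulMatrix σ x).det = (gradedLeftMulMatrix σ x).det := by
  rw [RingHom.map_det, ← Matrix.det_submatrix_equiv_self (Equiv.subRight (1 : Fin n))
    (gradedLeftMulMatrix σ x)]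
  congr 1
  ext1 k j
  have hσ' : σ⁻¹ ^ n = 1 := by rw [inv_pow, hσ, inv_one]
  have hpow : σ⁻¹ ^ ((k - 1 : Fin n) : ℕ) = σ * σ⁻¹ ^ (k : ℕ) := by
    have h := pow_fin_val_add hσ' (k - 1) 1
    rw [sub_add_cancel, Fin.val_one', ← pow_eq_pow_mod _ hσ', pow_one] at h
    rw [h, ← pow_succ, pow_succ', mul_inv_cancel_left]
  simp only [gradedLeftMulMatrix, RingHom.mapMatrix_apply, Matrix.map_apply, Matrix.of_apply,
    Matrix.submatrix_apply, Equiv.subRight_apply, sub_sub_sub_cancel_right, hpow]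
  simp

theorem det_leftMulMatrix_coeff_fixed [NeZero n] {σ : L ≃ₐ[F] L} (hσ : σ ^ n = 1)
    (x : Fin n → L) (m : ℕ) :
    σ ((leftMulMatrix σ x).det.coeff m) = (leftMulMatrix σ x).det.coeff m := by
  rw [← coeff_expand_mul (Nat.pos_of_neZero n), expand_det_leftMulMatrix]
  conv_rhs => rw [← map_det_gradedLeftMulMatrix hσ]
  simp

theorem det_leftMulMatrix_ne_zero [NeZero n] (σ : L ≃ₐ[F] L) {x : Fin n → L} (hx : x ≠ 0) :
    (leftMulMatrix σ x).det ≠ 0 := by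
  rw [← expand_ne_zero (Nat.pos_of_neZero n), expand_det_leftMulMatrix]
  obtain ⟨m, hm, hmax⟩ : ∃ m, x m ≠ 0 ∧ ∀ i, x i ≠ 0 → i ≤ m := by
    obtain ⟨i, hi⟩ := Function.ne_iff.1 hx
    obtain ⟨m, hm, h⟩ := Set.exists_max_image {i | x i ≠ 0} id (Set.toFinite _) ⟨i, hi⟩
    exact ⟨m, hm, h⟩
  have hdeg (k j : Fin n) : (gradedLeftMulMatrix σ x k j).natDegree ≤ m := by
    rw [gradedLeftMulMatrix, Matrix.of_apply]
    by_cases h : x (k - j) = 0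
    · simp [h]
    · exact (natDegree_C_mul_X_pow_le _ _).trans (hmax _ h)
  have hcoeff : (gradedLeftMulMatrix σ x).det.coeff (Fintype.card (Fin n) * m) =
      ((gradedLeftMulMatrix σ x).map fun p => p.coeff m).det := by
    simp only [Matrix.det_apply', finsetSum_coeff]
    refine Finset.sum_congr rfl fun π _ => ?_
    rw [← Finset.card_univ, ← C_eq_intCast, coeff_C_mul,
      coeff_prod_of_natDegree_le _ _ _ fun i _ => hdeg _ _]
    simp
  have hmonomial : (gradedLeftMulMatrix σ x).map (fun p => p.coeff m) =
      (Matrix.diagonal fun k : Fin n => (σ⁻¹ ^ (k : ℕ)) (x m)).submatrix id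
        (Equiv.addRight m) := by
    ext k j
    by_cases h : k = j + m
    · subst h
      simp [gradedLeftMulMatrix]
    · have h' : m ≠ k - j := fun h' => h (by rw [h', add_sub_cancel])
      simp [gradedLeftMulMatrix, coeff_X_pow, h, Fin.val_inj, h']
  intro h0
  rw [h0, coeff_zero, hmonomial, Matrix.det_permute', Matrix.det_diagonal] at hcoeff
  refine mul_ne_zero ?_ (Finset.prod_ne_zero_iff.2 fun k _ => ?_) hcoeff.symm
  · exact ((Equiv.Perm.sign (Equiv.addRight m)).isUnit.map (Int.castRingHom L)).ne_zero
  · simpa using hm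

/-- A nonzero polynomial of degree less than `n` with coefficients in `F` does not vanish at `a`
if `1, a, …, a ^ (n - 1)` are linearly independent over `F`. -/
theorem eval_ne_zero_of_linearIndependent_pow {a : L}
    (hli : LinearIndependent F fun i : Fin n => a ^ (i : ℕ)) {p : L[X]} (hp : p ≠ 0)
    (hdeg : p.natDegree < n) (hF : ∀ m, p.coeff m ∈ Set.range (algebraMap F L)) :
    p.eval a ≠ 0 := by
  choose c hc using hF
  intro h
  rw [eval_eq_sum_range' hdeg, Finset.sum_range] at h
  have h0 := Fintype.linearIndependent_iff.1 hli (fun i => c i)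
    (by simpa only [Algebra.smul_def, hc] using h)
  refine hp (leadingCoeff_eq_zero.1 ?_)
  rw [leadingCoeff, ← hc, h0 ⟨_, hdeg⟩, map_zero]

end

/-- if `1, a, a², …, a^(n-1)` are linearly independent over `F`,
then the nonassociative cyclic algebra `(L/F, σ, a)` is a division algebra. -/
theorem sandler_semifield_division
    {F L : Type*} [Field F] [Field L] [Algebra F L] [IsGalois F L]
    (n : ℕ) (hn : 2 ≤ n) (hrank : Module.finrank F L = n)
    (σ : L ≃ₐ[F] L) (hσ : ∀ τ : L ≃ₐ[F] L, τ ∈ Subgroup.zpowers σ)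
    (a : L) (ha : a ∉ Set.range (algebraMap F L))
    (hli : LinearIndependent F fun i : Fin n => a ^ (i : ℕ)) :
    ∀ x y : Fin n → L, cycMul n σ a x y = 0 → x = 0 ∨ y = 0 := by
  have : NeZero n := ⟨by omega⟩
  have : FiniteDimensional F L := FiniteDimensional.of_finrank_pos (by omega)
  have hσn : σ ^ n = 1 := by
    rw [← hrank, ← IsGalois.card_aut_eq_finrank]
    exact pow_card_eq_one'
  have hfixed (b : L) (hb : σ b = b) : b ∈ Set.range (algebraMap F L) := by
    refine (IsGalois.mem_range_algebraMap_iff_fixed b).2 fun τ => ?_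
    have hle : Subgroup.zpowers σ ≤ MulAction.stabilizer (L ≃ₐ[F] L) b :=
      Subgroup.zpowers_le.2 hb
    exact hle (hσ τ)
  have hdet (x : Fin n → L) (hx : x ≠ 0) :
      ((evalRingHom a).mapMatrix (leftMulMatrix σ x)).det ≠ 0 := by
    rw [← RingHom.map_det]
    exact eval_ne_zero_of_linearIndependent_pow hli (det_leftMulMatrix_ne_zero σ hx)
      (natDegree_det_leftMulMatrix_lt σ x)
      fun m => hfixed _ (det_leftMulMatrix_coeff_fixed hσn x m)
  intro x y hxy
  by_contra! h
  refine mul_ne_zero (hdet x h.1) (hdet y h.2) ?_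
  rw [← Matrix.det_mul]
  refine Matrix.det_eq_zero_of_row_eq_zero 0 fun j => ?_
  rw [eval_leftMulMatrix_mul_zero_row hσn, hxy, Pi.zero_apply, mul_zero]
end
end

section
/- Let A = (L/F, σ, a) be a nonassociative cyclic algebra of degree n. Then the middle nucleus and the right nucleus of A are both equal to L (identified with L z^0 ⊆ A); consequently the nucleus Nuc(A) equals L, and the centre Z(A) equals F. -/
noncomputable section

/-- The associator `[x,y,z] = (xy)z - x(yz)` in `(L/F, σ, a)`. -/
def cycAssoc {F L : Type*} [Field F] [Field L] [Algebra F L] (n : ℕ)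
    (σ : L ≃ₐ[F] L) (a : L) (x y z : Fin n → L) : Fin n → L :=
  cycMul n σ a (cycMul n σ a x y) z - cycMul n σ a x (cycMul n σ a y z)

/-- The embedding of `L` into `(L/F, σ, a)` as `L z^0`. -/
def cycEmb (L : Type*) [Field L] (n : ℕ) (l : L) : Fin n → L :=
  fun k => if (k : ℕ) = 0 then l else 0

section CyclicAlgebra

variable {F L : Type*} [Field F] [Field L] [Algebra F L] {n : ℕ} {σ : L ≃ₐ[F] L} {a : L}

theorem cycMul_single_left_of_add_eq (x : L) (y : Fin n → L) {i j k : Fin n}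
    (h : (i : ℕ) + j = k) :
    cycMul n σ a (Pi.single i x) y k = x * (σ ^ (i : ℕ)) (y j) := by
  unfold cycMul
  rw [Finset.sum_eq_single i, Finset.sum_eq_single j]
  · simp [h]
  · intro b _ hb
    rw [if_neg (by grind), if_neg (by grind)]
  · simp
  · intro b _ hb
    simp [Pi.single_eq_of_ne hb]
  · simp

theorem cycMul_single_left_of_add_eq_add (x : L) (y : Fin n → L) {i j k : Fin n}
    (h : (i : ℕ) + j = k + n) :
    cycMul n σ a (Pi.single i x) y k = x * (σ ^ (i : ℕ)) (y j) * a := by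
  unfold cycMul
  rw [Finset.sum_eq_single i, Finset.sum_eq_single j]
  · rw [if_neg (by grind), if_pos h, Pi.single_eq_same]
  · intro b _ hb
    rw [if_neg (by grind), if_neg (by grind)]
  · simp
  · intro b _ hb
    simp [Pi.single_eq_of_ne hb]
  · simp

theorem cycMul_single_right_of_add_eq (x : Fin n → L) (y : L) {i j k : Fin n}
    (h : (i : ℕ) + j = k) :
    cycMul n σ a x (Pi.single j y) k = x i * (σ ^ (i : ℕ)) y := by
  unfold cycMul
  rw [Finset.sum_comm, Finset.sum_eq_single j, Finset.sum_eq_single i]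
  · simp [h]
  · intro b _ hb
    rw [if_neg (by grind), if_neg (by grind)]
  · simp
  · intro b _ hb
    simp [Pi.single_eq_of_ne hb]
  · simp

theorem cycMul_single_right_of_add_eq_add (x : Fin n → L) (y : L) {i j k : Fin n}
    (h : (i : ℕ) + j = k + n) :
    cycMul n σ a x (Pi.single j y) k = x i * (σ ^ (i : ℕ)) y * a := by
  unfold cycMul
  rw [Finset.sum_comm, Finset.sum_eq_single j, Finset.sum_eq_single i]
  · rw [if_neg (by grind), if_pos h, Pi.single_eq_same]
  · intro b _ hb
    rw [if_neg (by grind), if_neg (by grind)]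
  · simp
  · intro b _ hb
    simp [Pi.single_eq_of_ne hb]
  · simp

theorem cycEmb_eq_single [NeZero n] (l : L) : cycEmb L n l = Pi.single 0 l := by
  ext k
  simp [cycEmb, Pi.single_apply]

theorem eq_cycEmb_of_forall_ne_zero [NeZero n] {y : Fin n → L}
    (h : ∀ j : Fin n, j ≠ 0 → y j = 0) : y = cycEmb L n (y 0) := by
  ext k
  by_cases hk : k = 0
  · simp [cycEmb_eq_single, hk]
  · simp [cycEmb_eq_single, hk, h k hk]

theorem cycMul_cycEmb_left [NeZero n] (l : L) (y : Fin n → L) :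
    cycMul n σ a (cycEmb L n l) y = fun k => l * y k := by
  ext k
  rw [cycEmb_eq_single, cycMul_single_left_of_add_eq l y (j := k) (by simp)]
  simp

theorem cycMul_cycEmb_right [NeZero n] (x : Fin n → L) (l : L) :
    cycMul n σ a x (cycEmb L n l) = fun k => x k * (σ ^ (k : ℕ)) l := by
  ext k
  rw [cycEmb_eq_single, cycMul_single_right_of_add_eq x l (i := k) (by simp)]

theorem cycAssoc_cycEmb_left [NeZero n] (l : L) (y z : Fin n → L) :
    cycAssoc n σ a (cycEmb L n l) y z = 0 := by
  rw [cycAssoc, sub_eq_zero, cycMul_cycEmb_left, cycMul_cycEmb_left]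
  ext k
  simp only [cycMul, Finset.mul_sum, mul_ite, mul_zero, mul_assoc]

theorem cycAssoc_cycEmb_middle [NeZero n] (l : L) (x z : Fin n → L) :
    cycAssoc n σ a x (cycEmb L n l) z = 0 := by
  rw [cycAssoc, sub_eq_zero, cycMul_cycEmb_left, cycMul_cycEmb_right]
  ext k
  simp only [cycMul, map_mul, mul_assoc]

theorem cycAssoc_cycEmb_right [NeZero n] (hσn : σ ^ n = 1) (l : L) (x y : Fin n → L) :
    cycAssoc n σ a x y (cycEmb L n l) = 0 := by
  rw [cycAssoc, sub_eq_zero, cycMul_cycEmb_right, cycMul_cycEmb_right]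
  ext k
  simp only [cycMul, map_mul, Finset.sum_mul, ite_mul, zero_mul]
  refine Finset.sum_congr rfl fun i _ => Finset.sum_congr rfl fun j _ => ?_
  rw [← AlgEquiv.mul_apply (σ ^ (i : ℕ)) (σ ^ (j : ℕ)) l, ← pow_add]
  split_ifs with h₁ h₂
  · rw [h₁]
    ring
  · rw [h₂, pow_add, hσn, mul_one]
    ring
  · rfl

theorem cycAssoc_single_middle_apply_one (hn : 1 < n) (y : Fin n → L) {j k : Fin n}
    (h : (j : ℕ) + k = n) :
    cycAssoc n σ a (Pi.single ⟨1, hn⟩ 1) y (Pi.single k 1) ⟨1, hn⟩ =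
      σ (y j) * (a - σ a) := by
  have h₀ : cycMul n σ a y (Pi.single k 1) ⟨0, by omega⟩ = y j * a := by
    rw [cycMul_single_right_of_add_eq_add y 1 (i := j) (by simpa using h)]
    simp
  have h₁ : cycMul n σ a (cycMul n σ a (Pi.single ⟨1, hn⟩ 1) y) (Pi.single k 1) ⟨1, hn⟩ =
      σ (y j) * a := by
    by_cases hj : (j : ℕ) + 1 < n
    · rw [cycMul_single_right_of_add_eq_add _ 1 (i := ⟨j + 1, hj⟩) (by simp; omega),
        cycMul_single_left_of_add_eq 1 y (j := j) (by simp; omega)]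
      simp
    · rw [cycMul_single_right_of_add_eq _ 1 (i := ⟨0, by omega⟩) (by simp; omega),
        cycMul_single_left_of_add_eq_add 1 y (j := j) (by simp; omega)]
      simp
  rw [cycAssoc, Pi.sub_apply, h₁,
    cycMul_single_left_of_add_eq 1 _ (j := ⟨0, by omega⟩) (by simp), h₀]
  simp
  ring

theorem cycAssoc_single_right_apply_one (hn : 1 < n) (hσn : σ ^ n = 1) (y : Fin n → L)
    {j k : Fin n} (h : (k : ℕ) + j = n) :
    cycAssoc n σ a (Pi.single ⟨1, hn⟩ 1) (Pi.single k 1) y ⟨1, hn⟩ =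
      (σ ^ ((k : ℕ) + 1)) (y j) * (a - σ a) := by
  have h₀ : cycMul n σ a (Pi.single k 1) y ⟨0, by omega⟩ = (σ ^ (k : ℕ)) (y j) * a := by
    rw [cycMul_single_left_of_add_eq_add 1 y (j := j) (by simpa using h)]
    simp
  have h₁ : cycMul n σ a (cycMul n σ a (Pi.single ⟨1, hn⟩ 1) (Pi.single k 1)) y ⟨1, hn⟩ =
      (σ ^ ((k : ℕ) + 1)) (y j) * a := by
    by_cases hk : (k : ℕ) + 1 < n
    · have hs : cycMul n σ a (Pi.single ⟨1, hn⟩ 1) (Pi.single k 1) =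
          Pi.single (⟨k + 1, hk⟩ : Fin n) 1 := by
        ext m
        by_cases hm : (m : ℕ) = 0
        · rw [cycMul_single_left_of_add_eq_add 1 _ (j := ⟨n - 1, by omega⟩)
            (by simp; omega)]
          grind
        · rw [cycMul_single_left_of_add_eq 1 _ (j := ⟨m - 1, by omega⟩)
            (by simp; omega)]
          simp only [Pi.single_apply, Fin.ext_iff]
          grind
      rw [hs, cycMul_single_left_of_add_eq_add 1 y (j := j) (by simp; omega)]
      simp
    · have hs : cycMul n σ a (Pi.single ⟨1, hn⟩ 1) (Pi.single k 1) =
          Pi.single (⟨0, by omega⟩ : Fin n) a := by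
        ext m
        by_cases hm : (m : ℕ) = 0
        · rw [cycMul_single_left_of_add_eq_add 1 _ (j := k) (by simp; omega)]
          simp [Pi.single_apply, Fin.ext_iff, hm]
        · rw [cycMul_single_left_of_add_eq 1 _ (j := ⟨m - 1, by omega⟩)
            (by simp; omega)]
          simp only [Pi.single_apply, Fin.ext_iff]
          grind
      rw [hs, cycMul_single_left_of_add_eq a y (j := j) (by simp; omega),
        show (k : ℕ) + 1 = n by omega, hσn]
      simp [mul_comm]
  rw [cycAssoc, Pi.sub_apply, h₁,
    cycMul_single_left_of_add_eq 1 _ (j := ⟨0, by omega⟩) (by simp), h₀]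
  simp [pow_succ']
  ring

theorem setOf_cycAssoc_middle_eq_zero (hn : 1 < n) (ha : σ a ≠ a) :
    {y : Fin n → L | ∀ x z : Fin n → L, cycAssoc n σ a x y z = 0} =
      Set.range (cycEmb L n) := by
  have : NeZero n := ⟨by omega⟩
  refine Set.Subset.antisymm (fun y hy => ?_) ?_
  · refine ⟨y 0, (eq_cycEmb_of_forall_ne_zero fun j hj => ?_).symm⟩
    have hj₀ : (j : ℕ) ≠ 0 := by simpa using hj
    have h := cycAssoc_single_middle_apply_one (σ := σ) (a := a) hn y (j := j)
      (k := ⟨n - j, by omega⟩) (by simp)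
    rw [hy, Pi.zero_apply, eq_comm, mul_eq_zero, sub_eq_zero] at h
    simpa using h.resolve_right ha.symm
  · rintro _ ⟨l, rfl⟩ x z
    exact cycAssoc_cycEmb_middle l x z

theorem setOf_cycAssoc_right_eq_zero (hn : 1 < n) (hσn : σ ^ n = 1) (ha : σ a ≠ a) :
    {z : Fin n → L | ∀ x y : Fin n → L, cycAssoc n σ a x y z = 0} =
      Set.range (cycEmb L n) := by
  have : NeZero n := ⟨by omega⟩
  refine Set.Subset.antisymm (fun z hz => ?_) ?_
  · refine ⟨z 0, (eq_cycEmb_of_forall_ne_zero fun j hj => ?_).symm⟩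
    have hj₀ : (j : ℕ) ≠ 0 := by simpa using hj
    have h := cycAssoc_single_right_apply_one (a := a) hn hσn z (j := j)
      (k := ⟨n - j, by omega⟩) (by simp)
    rw [hz, Pi.zero_apply, eq_comm, mul_eq_zero, sub_eq_zero] at h
    exact (map_eq_zero_iff _ (AlgEquiv.injective _)).mp (h.resolve_right ha.symm)
  · rintro _ ⟨l, rfl⟩ x y
    exact cycAssoc_cycEmb_right hσn l x y

theorem cycMul_cycEmb_comm_iff (hn : 1 < n) (l : L) :
    (∀ y : Fin n → L, cycMul n σ a (cycEmb L n l) y = cycMul n σ a y (cycEmb L n l)) ↔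
      σ l = l := by
  have : NeZero n := ⟨by omega⟩
  simp only [cycMul_cycEmb_left, cycMul_cycEmb_right]
  refine ⟨fun h => ?_, fun h y => ?_⟩
  · simpa using (congrFun (h 1) ⟨1, hn⟩).symm
  · ext k
    rw [show (σ ^ (k : ℕ)) l = l by
      rw [AlgEquiv.coe_pow]; exact Function.iterate_fixed h _, mul_comm]

theorem mem_range_algebraMap_iff_of_forall_mem_zpowers [FiniteDimensional F L] [IsGalois F L]
    (hσ : ∀ τ : L ≃ₐ[F] L, τ ∈ Subgroup.zpowers σ) (l : L) :
    l ∈ Set.range (algebraMap F L) ↔ σ l = l := by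
  rw [IsGalois.mem_range_algebraMap_iff_fixed]
  refine ⟨fun h => h σ, fun h τ => ?_⟩
  have hs : Subgroup.zpowers σ ≤ MulAction.stabilizer (L ≃ₐ[F] L) l := by
    rw [Subgroup.zpowers_le]
    exact h
  exact hs (hσ τ)

end CyclicAlgebra

/-- the middle and right nuclei of the nonassociative cyclic algebra
`A = (L/F, σ, a)` are both equal to `L` (embedded as `L z^0`); consequently the nucleus
`Nuc(A)` equals `L` and the centre `Z(A)` equals `F`. -/
theorem sandler_semifield_nuclei_and_centre
    {F L : Type*} [Field F] [Field L] [Algebra F L] [IsGalois F L]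
    (n : ℕ) (hn : 2 ≤ n) (hrank : Module.finrank F L = n)
    (σ : L ≃ₐ[F] L) (hσ : ∀ τ : L ≃ₐ[F] L, τ ∈ Subgroup.zpowers σ)
    (a : L) (ha : a ∉ Set.range (algebraMap F L)) :
    {y : Fin n → L | ∀ x z : Fin n → L, cycAssoc n σ a x y z = 0}
        = Set.range (cycEmb L n) ∧
    {z : Fin n → L | ∀ x y : Fin n → L, cycAssoc n σ a x y z = 0}
        = Set.range (cycEmb L n) ∧
    {w : Fin n → L | (∀ y z : Fin n → L, cycAssoc n σ a w y z = 0) ∧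
        (∀ x z : Fin n → L, cycAssoc n σ a x w z = 0) ∧
        (∀ x y : Fin n → L, cycAssoc n σ a x y w = 0)}
        = Set.range (cycEmb L n) ∧
    {w : Fin n → L | (∀ y z : Fin n → L, cycAssoc n σ a w y z = 0) ∧
        (∀ x z : Fin n → L, cycAssoc n σ a x w z = 0) ∧
        (∀ x y : Fin n → L, cycAssoc n σ a x y w = 0) ∧
        (∀ y : Fin n → L, cycMul n σ a w y = cycMul n σ a y w)}
        = Set.range (fun f : F => cycEmb L n (algebraMap F L f)) := by
  have hn' : 1 < n := hn
  have : NeZero n := ⟨by omega⟩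
  have : FiniteDimensional F L := Module.finite_of_finrank_pos (by omega)
  have hσn : σ ^ n = 1 := by
    rw [← hrank, ← IsGalois.card_aut_eq_finrank F L]
    exact pow_card_eq_one'
  have ha' : σ a ≠ a := by
    rwa [Ne, ← mem_range_algebraMap_iff_of_forall_mem_zpowers hσ]
  have hm := setOf_cycAssoc_middle_eq_zero hn' ha'
  refine ⟨hm, setOf_cycAssoc_right_eq_zero hn' hσn ha', ?_, ?_⟩
  · refine Set.Subset.antisymm (fun w hw => hm.subset hw.2.1) ?_
    rintro _ ⟨l, rfl⟩
    exact ⟨cycAssoc_cycEmb_left l, cycAssoc_cycEmb_middle l, cycAssoc_cycEmb_right hσn l⟩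
  · refine Set.Subset.antisymm (fun w hw => ?_) ?_
    · obtain ⟨l, rfl⟩ := hm.subset hw.2.1
      obtain ⟨f, rfl⟩ := (mem_range_algebraMap_iff_of_forall_mem_zpowers hσ l).mpr
        ((cycMul_cycEmb_comm_iff hn' l).mp hw.2.2.2)
      exact ⟨f, rfl⟩
    · rintro _ ⟨f, rfl⟩
      exact ⟨cycAssoc_cycEmb_left _, cycAssoc_cycEmb_middle _, cycAssoc_cycEmb_right hσn _,
        (cycMul_cycEmb_comm_iff hn' _).mpr (σ.commutes f)⟩
end
end

section
/- Let A = (L/F, σ, a) and B = (L/F, σ, b) be nonassociative cyclic algebras of degree n, with a, b ∈ L \ F. Then A and B are isomorphic as F-algebras (i.e. there is an F-linear bijection between them preserving multiplication and the unit) if and only if there exist an integer i with 0 ≤ i < n and an element l ∈ L^× such that σ^i(a) = N_{L/F}(l) · b, where N_{L/F} denotes the field norm of L over F. -/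
noncomputable section

/-- The unit element `1 = z^0` of `(L/F, σ, a)`. -/
def cycOne (L : Type*) [Field L] (n : ℕ) : Fin n → L :=
  fun k => if (k : ℕ) = 0 then 1 else 0

/-- The monomial `x z^p`. -/
def cycMonomial {L : Type*} [Field L] (n p : ℕ) (x : L) : Fin n → L :=
  fun k => if (k : ℕ) = p then x else 0

section CyclicAlgebra

variable {F L : Type*} [Field F] [Field L] [Algebra F L]

lemma cycMonomial_mul {n p : ℕ} (hp : p < n) (σ : L ≃ₐ[F] L) (a x : L) (y : Fin n → L)
    (k : Fin n) :
    cycMul n σ a (cycMonomial n p x) y k =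
      if h : p ≤ k then x * (σ ^ p) (y ⟨k - p, by omega⟩)
      else x * (σ ^ p) (y ⟨k + n - p, by omega⟩) * a := by
  unfold cycMul cycMonomial
  rw [Finset.sum_eq_single (⟨p, hp⟩ : Fin n)]
  · by_cases h : p ≤ k
    · rw [dif_pos h, Finset.sum_eq_single (⟨k - p, by omega⟩ : Fin n)]
      · simp [Nat.add_sub_cancel' h]
      · intro j _ hj
        have : (j : ℕ) ≠ k - p := fun h' => hj (Fin.ext h')
        rw [if_neg (by simp only; omega), if_neg (by simp only; omega)]
      · simp
    · rw [dif_neg h, Finset.sum_eq_single (⟨k + n - p, by omega⟩ : Fin n)]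
      · rw [if_neg (by simp only; omega), if_pos (by simp only; omega)]
        simp
      · intro j _ hj
        have : (j : ℕ) ≠ k + n - p := fun h' => hj (Fin.ext h')
        rw [if_neg (by simp only; omega), if_neg (by simp only; omega)]
      · simp
  · intro i _ hi
    have : (i : ℕ) ≠ p := fun h' => hi (Fin.ext h')
    simp [this]
  · simp

lemma cycMonomial_mul_cycMonomial_of_lt {n p q : ℕ} (h : p + q < n) (σ : L ≃ₐ[F] L)
    (a x y : L) :
    cycMul n σ a (cycMonomial n p x) (cycMonomial n q y) =
      cycMonomial n (p + q) (x * (σ ^ p) y) := by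
  ext k
  rw [cycMonomial_mul (by omega)]
  unfold cycMonomial
  simp only
  split_ifs <;> first | omega | simp

lemma cycMonomial_mul_cycMonomial_of_le {n p q : ℕ} (hp : p < n) (hq : q < n) (h : n ≤ p + q)
    (σ : L ≃ₐ[F] L) (a x y : L) :
    cycMul n σ a (cycMonomial n p x) (cycMonomial n q y) =
      cycMonomial n (p + q - n) (x * (σ ^ p) y * a) := by
  ext k
  rw [cycMonomial_mul hp]
  unfold cycMonomial
  simp only
  split_ifs <;> first | omega | simp

lemma cycMul_cycMonomial_zero {n : ℕ} (σ : L ≃ₐ[F] L) (a x : L) (v : Fin n → L) (k : Fin n) :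
    cycMul n σ a v (cycMonomial n 0 x) k = v k * (σ ^ (k : ℕ)) x := by
  unfold cycMul cycMonomial
  rw [Finset.sum_eq_single k]
  · rw [Finset.sum_eq_single (⟨0, k.pos⟩ : Fin n)]
    · simp
    · intro j _ hj
      have : (j : ℕ) ≠ 0 := fun h' => hj (Fin.ext h')
      simp [this]
    · simp
  · intro i _ hi
    have : (i : ℕ) ≠ k := fun h' => hi (Fin.ext h')
    refine Finset.sum_eq_zero fun j _ => ?_
    by_cases hj : (j : ℕ) = 0
    · rw [if_neg (by omega), if_neg (by omega)]
    · simp [hj]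
  · simp

/-- Every element of `L` lies in the right nucleus. -/
lemma cycMul_assoc_cycMonomial_zero {n : ℕ} {σ : L ≃ₐ[F] L} (hσn : σ ^ n = 1) (a x : L)
    (u v : Fin n → L) :
    cycMul n σ a (cycMul n σ a u v) (cycMonomial n 0 x) =
      cycMul n σ a u (cycMul n σ a v (cycMonomial n 0 x)) := by
  ext k
  rw [cycMul_cycMonomial_zero]
  simp only [cycMul, Finset.sum_mul]
  refine Finset.sum_congr rfl fun i _ => Finset.sum_congr rfl fun j _ => ?_
  have hij : (σ ^ (i : ℕ)) ((σ ^ (j : ℕ)) x) = (σ ^ ((i : ℕ) + j)) x := by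
    rw [pow_add, AlgEquiv.mul_apply]
  change _ = ite _ (u i * (σ ^ (i : ℕ)) (cycMul n σ a v (cycMonomial n 0 x) j)) _
  split_ifs with h1 h2
  · rw [cycMul_cycMonomial_zero, map_mul, hij, h1]; ring
  · change _ = u i * (σ ^ (i : ℕ)) (cycMul n σ a v (cycMonomial n 0 x) j) * a
    rw [cycMul_cycMonomial_zero, map_mul, hij, h2, pow_add, hσn, mul_one]; ring
  · simp

/-- An element that associates on the right with `z` and `z^(n-1)` lies in `L`. -/
lemma eq_cycMonomial_zero_of_assoc {n : ℕ} (hn : 2 ≤ n) {σ : L ≃ₐ[F] L} (hσn : σ ^ n = 1)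
    {a : L} (ha : σ a ≠ a) {y : Fin n → L}
    (h : cycMul n σ a (cycMul n σ a (cycMonomial n 1 1) (cycMonomial n (n - 1) 1)) y =
      cycMul n σ a (cycMonomial n 1 1) (cycMul n σ a (cycMonomial n (n - 1) 1) y)) :
    y = cycMonomial n 0 (y ⟨0, by omega⟩) := by
  ext k
  by_cases hk : (k : ℕ) = 0
  · have : k = ⟨0, by omega⟩ := Fin.ext hk
    simp [this, cycMonomial]
  · have hk' := congrFun h k
    rw [cycMonomial_mul_cycMonomial_of_le (by omega) (by omega) (by omega),
      show 1 + (n - 1) - n = 0 by omega, cycMonomial_mul (by omega), cycMonomial_mul (by omega),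
      dif_pos (by omega), dif_pos (by omega), cycMonomial_mul (by omega),
      dif_neg (by simp only; omega)] at hk'
    have e1 : (⟨(k : ℕ) - 1 + n - (n - 1), by omega⟩ : Fin n) = k :=
      Fin.ext (by simp only; omega)
    have e2 : ∀ w, σ ((σ ^ (n - 1)) w) = w := fun w => by
      rw [← AlgEquiv.mul_apply, ← pow_succ', Nat.sub_add_cancel (by omega), hσn,
        AlgEquiv.one_apply]
    simp only [e1, pow_one, map_one, one_mul, mul_one, pow_zero, AlgEquiv.one_apply, map_mul,
      e2, Nat.sub_zero, Fin.eta] at hk'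
    have : (σ a - a) * y k = 0 := by linear_combination -hk'
    simpa [cycMonomial, hk] using (mul_eq_zero.mp this).resolve_left (sub_ne_zero.mpr ha)

/-- The coefficient `l σ(l) ⋯ σ^(k-1)(l)` of `(l z)^k`. -/
def partialNorm (σ : L ≃ₐ[F] L) (l : L) (k : ℕ) : L :=
  ∏ j ∈ Finset.range k, (σ ^ j) l

lemma partialNorm_add (σ : L ≃ₐ[F] L) (l : L) (p q : ℕ) :
    partialNorm σ l (p + q) = partialNorm σ l p * (σ ^ p) (partialNorm σ l q) := by
  simp only [partialNorm, Finset.prod_range_add, map_prod, pow_add, AlgEquiv.mul_apply]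

lemma partialNorm_ne_zero (σ : L ≃ₐ[F] L) {l : L} (hl : l ≠ 0) (k : ℕ) :
    partialNorm σ l k ≠ 0 :=
  Finset.prod_ne_zero_iff.mpr fun j _ =>
    (map_ne_zero_iff (σ ^ j) (σ ^ j).injective).mpr hl

lemma exists_lt_orderOf_pow_eq {G : Type*} [Group G] [Finite G] {x y : G}
    (h : y ∈ Subgroup.zpowers x) : ∃ k < orderOf x, x ^ k = y := by
  classical
  simpa using mem_zpowers_iff_mem_range_orderOf.mp h

lemma partialNorm_orderOf [FiniteDimensional F L] [IsGalois F L] {σ : L ≃ₐ[F] L}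
    (hσ : ∀ τ : L ≃ₐ[F] L, τ ∈ Subgroup.zpowers σ) (l : L) :
    partialNorm σ l (orderOf σ) = algebraMap F L (Algebra.norm F l) := by
  classical
  rw [Algebra.norm_eq_prod_automorphisms, partialNorm]
  refine Finset.prod_bij (fun j _ => σ ^ j) (by simp) ?_ ?_ (fun _ _ => rfl)
  · intro i hi j hj h
    exact pow_injOn_Iio_orderOf (Finset.mem_range.mp hi) (Finset.mem_range.mp hj) h
  · intro τ _
    obtain ⟨k, hk, h⟩ := exists_lt_orderOf_pow_eq (hσ τ)
    exact ⟨k, Finset.mem_range.mpr hk, h⟩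

lemma apply_ne_self_of_notMem_range [FiniteDimensional F L] [IsGalois F L] {σ : L ≃ₐ[F] L}
    (hσ : ∀ τ : L ≃ₐ[F] L, τ ∈ Subgroup.zpowers σ) {a : L}
    (ha : a ∉ Set.range (algebraMap F L)) : σ a ≠ a := by
  intro h
  refine ha ((IsGalois.mem_range_algebraMap_iff_fixed a).mpr fun τ => ?_)
  have : Subgroup.zpowers σ ≤ MulAction.stabilizer (L ≃ₐ[F] L) a :=
    Subgroup.zpowers_le.mpr h
  exact this (hσ τ)

/-- The `F`-linear bijection `∑ x_k z^k ↦ ∑ τ(x_k) c_k z^k`. -/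
def diagonalEquiv {n : ℕ} (τ : L ≃ₐ[F] L) (c : Fin n → L) (hc : ∀ k, c k ≠ 0) :
    (Fin n → L) ≃ₗ[F] (Fin n → L) where
  toFun x k := τ (x k) * c k
  invFun x k := τ.symm (x k / c k)
  map_add' x y := by ext k; simp [add_mul]
  map_smul' r x := by ext k; simp
  left_inv x := by ext k; simp [hc k]
  right_inv x := by ext k; simp [hc k]

lemma diagonalEquiv_cycMul {n : ℕ} {σ : L ≃ₐ[F] L} (hσn : σ ^ n = 1) {a b l : L} (i : ℕ)
    (hl : l ≠ 0) (h : (σ ^ i) a = partialNorm σ l n * b) (x y : Fin n → L) :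
    diagonalEquiv (σ ^ i) (fun k => partialNorm σ l k) (fun k => partialNorm_ne_zero σ hl k)
        (cycMul n σ a x y) =
      cycMul n σ b
        (diagonalEquiv (σ ^ i) (fun k => partialNorm σ l k)
          (fun k => partialNorm_ne_zero σ hl k) x)
        (diagonalEquiv (σ ^ i) (fun k => partialNorm σ l k)
          (fun k => partialNorm_ne_zero σ hl k) y) := by
  ext k
  simp only [diagonalEquiv, LinearEquiv.coe_mk, LinearMap.coe_mk, AddHom.coe_mk, cycMul, map_sum,
    Finset.sum_mul]
  refine Finset.sum_congr rfl fun p _ => Finset.sum_congr rfl fun q _ => ?_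
  have hcomm : (σ ^ i) ((σ ^ (p : ℕ)) (y q)) = (σ ^ (p : ℕ)) ((σ ^ i) (y q)) := by
    rw [← AlgEquiv.mul_apply, ← AlgEquiv.mul_apply, pow_mul_comm]
  have hadd := partialNorm_add σ l p q
  split_ifs with h1 h2
  · rw [h1] at hadd
    rw [hadd, map_mul, map_mul, hcomm]
    ring
  · rw [h2, add_comm, partialNorm_add, hσn, AlgEquiv.one_apply] at hadd
    rw [map_mul, map_mul, map_mul, hcomm, h]
    linear_combination (σ ^ i) (x p) * (σ ^ (p : ℕ)) ((σ ^ i) (y q)) * b * hadd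
  · simp

/-- The restriction to `L` of a multiplicative unital map sending `L` into `L`. -/
def restrictCoeff {n : ℕ} (hn : 0 < n) {σ : L ≃ₐ[F] L} {a b : L}
    (e : (Fin n → L) →ₗ[F] (Fin n → L))
    (hmul : ∀ x y, e (cycMul n σ a x y) = cycMul n σ b (e x) (e y))
    (hone : e (cycOne L n) = cycOne L n)
    (he : ∀ x, e (cycMonomial n 0 x) = cycMonomial n 0 (e (cycMonomial n 0 x) ⟨0, hn⟩)) :
    L →ₐ[F] L :=
  AlgHom.ofLinearMap
    { toFun := fun x => e (cycMonomial n 0 x) ⟨0, hn⟩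
      map_add' := fun x y => by
        have : cycMonomial n 0 (x + y) = cycMonomial n 0 x + cycMonomial n 0 y := by
          ext k; by_cases hk : (k : ℕ) = 0 <;> simp [cycMonomial, hk]
        rw [this, map_add, Pi.add_apply]
      map_smul' := fun r x => by
        have : cycMonomial n 0 (r • x) = r • cycMonomial n 0 x := by
          ext k; by_cases hk : (k : ℕ) = 0 <;> simp [cycMonomial, hk]
        rw [this, map_smul, Pi.smul_apply, RingHom.id_apply] }
    (by
      change e (cycOne L n) ⟨0, hn⟩ = 1
      rw [hone]
      simp [cycOne])
    (fun x y => by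
      have h := cycMonomial_mul_cycMonomial_of_lt (p := 0) (q := 0) hn σ a x y
      rw [pow_zero, AlgEquiv.one_apply] at h
      change e (cycMonomial n 0 (x * y)) ⟨0, hn⟩ = _
      rw [← h, hmul, he y, cycMul_cycMonomial_zero, pow_zero, AlgEquiv.one_apply]
      rfl)

end CyclicAlgebra

/-- the nonassociative cyclic algebras `A = (L/F, σ, a)` and `B = (L/F, σ, b)`
are isomorphic as `F`-algebras if and only if `σ^i(a) = N_{L/F}(l)·b` for some `0 ≤ i < n`
and some `l ∈ Lˣ`. -/
theorem sandler_iso_iff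
    {F L : Type*} [Field F] [Field L] [Algebra F L] [IsGalois F L]
    (n : ℕ) (hn : 2 ≤ n) (hrank : Module.finrank F L = n)
    (σ : L ≃ₐ[F] L) (hσ : ∀ τ : L ≃ₐ[F] L, τ ∈ Subgroup.zpowers σ)
    (a b : L) (ha : a ∉ Set.range (algebraMap F L)) (hb : b ∉ Set.range (algebraMap F L)) :
    (∃ e : (Fin n → L) ≃ₗ[F] (Fin n → L),
        (∀ x y : Fin n → L, e (cycMul n σ a x y) = cycMul n σ b (e x) (e y)) ∧
        e (cycOne L n) = cycOne L n) ↔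
      ∃ i : ℕ, i < n ∧ ∃ l : L, l ≠ 0 ∧
        (σ ^ i) a = algebraMap F L (Algebra.norm F l) * b := by
  have hfd : FiniteDimensional F L := FiniteDimensional.of_finrank_pos (by omega)
  have hord : orderOf σ = n := by
    rw [orderOf_eq_card_of_forall_mem_zpowers hσ, IsGalois.card_aut_eq_finrank, hrank]
  have hσn : σ ^ n = 1 := hord ▸ pow_orderOf_eq_one σ
  have hnorm : ∀ l, partialNorm σ l n = algebraMap F L (Algebra.norm F l) := fun l =>
    hord ▸ partialNorm_orderOf hσ l
  constructor
  · rintro ⟨e, hmul, hone⟩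
    have he : ∀ x, e (cycMonomial n 0 x) =
        cycMonomial n 0 (e (cycMonomial n 0 x) ⟨0, by omega⟩) := fun x => by
      refine eq_cycMonomial_zero_of_assoc hn hσn (apply_ne_self_of_notMem_range hσ hb) ?_
      obtain ⟨u, hu⟩ := e.surjective (cycMonomial n 1 1)
      obtain ⟨v, hv⟩ := e.surjective (cycMonomial n (n - 1) 1)
      rw [← hu, ← hv, ← hmul, ← hmul, ← hmul, ← hmul, cycMul_assoc_cycMonomial_zero hσn]
    obtain ⟨τ, hτ⟩ := (algEquivEquivAlgHom F L).surjective
      (restrictCoeff (by omega) e.toLinearMap hmul hone he)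
    obtain ⟨i, hi, rfl⟩ :=
      exists_lt_orderOf_pow_eq (hσ τ)
    have hL : ∀ x, e (cycMonomial n 0 x) = cycMonomial n 0 ((σ ^ i) x) := fun x => by
      rw [he x]
      exact congrArg _ (DFunLike.congr_fun hτ x).symm
    set w := e (cycMonomial n 1 1) with hw
    have hwk : ∀ k : Fin n, (k : ℕ) ≠ 1 → w k = 0 := by
      intro k hk
      by_contra hne
      refine hk (pow_injOn_Iio_orderOf (x := σ) (by simp [hord]) (by simp [hord]; omega) ?_)
      ext x
      obtain ⟨x, rfl⟩ := (σ ^ i).surjective x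
      have h : cycMul n σ a (cycMonomial n 1 1) (cycMonomial n 0 x) =
          cycMul n σ a (cycMonomial n 0 (σ x)) (cycMonomial n 1 1) := by
        rw [cycMonomial_mul_cycMonomial_of_lt (by omega),
          cycMonomial_mul_cycMonomial_of_lt (by omega)]
        simp
      have h' := congrFun (congrArg e h) k
      rw [hmul, hmul, hL, hL, cycMul_cycMonomial_zero, cycMonomial_mul (by omega),
        dif_pos (Nat.zero_le _)] at h'
      simp only [pow_zero, AlgEquiv.one_apply, Nat.sub_zero, Fin.eta, ← hw] at h'
      have hcomm : (σ ^ i) (σ x) = (σ ^ 1) ((σ ^ i) x) := by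
        rw [pow_one, ← AlgEquiv.mul_apply, ← AlgEquiv.mul_apply, ← pow_succ, pow_succ']
      rw [hcomm, mul_comm] at h'
      exact mul_right_cancel₀ hne h'
    obtain ⟨l, hl⟩ : ∃ l, w = cycMonomial n 1 l := by
      refine ⟨w ⟨1, by omega⟩, funext fun k => ?_⟩
      by_cases hk : (k : ℕ) = 1
      · have : k = ⟨1, by omega⟩ := Fin.ext hk
        simp [this, cycMonomial]
      · simp [cycMonomial, hk, hwk k hk]
    have hpow : ∀ k, k < n → e (cycMonomial n k 1) = cycMonomial n k (partialNorm σ l k) := by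
      intro k
      induction k with
      | zero => intro _; simpa [partialNorm] using hL 1
      | succ k ih =>
        intro hk
        have h := cycMonomial_mul_cycMonomial_of_lt (p := 1) (q := k) (n := n) (by omega) σ a 1 1
        rw [map_one, one_mul, add_comm] at h
        rw [← h, hmul, ih (by omega), ← hw, hl, cycMonomial_mul_cycMonomial_of_lt (by omega),
          add_comm k 1, partialNorm_add]
        simp [partialNorm]
    refine ⟨i, hord ▸ hi, l, ?_, ?_⟩
    · rintro rfl
      have h0 : w = 0 := by rw [hl]; ext k; simp [cycMonomial]
      have h1 := congrFun (e.map_eq_zero_iff.mp h0) ⟨1, by omega⟩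
      simp [cycMonomial] at h1
    · have h := cycMonomial_mul_cycMonomial_of_le (p := 1) (q := n - 1) (n := n) (by omega)
        (by omega) (by omega) σ a 1 1
      have h' := congrArg e h
      rw [hmul, hpow (n - 1) (by omega), ← hw, hl, cycMonomial_mul_cycMonomial_of_le (by omega)
        (by omega) (by omega), show 1 + (n - 1) - n = 0 by omega, hL] at h'
      have h0 := congrFun h' ⟨0, by omega⟩
      have hadd := partialNorm_add σ l 1 (n - 1)
      rw [show 1 + (n - 1) = n by omega, hnorm] at hadd
      rw [hadd]
      simpa [cycMonomial, partialNorm] using h0.symm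
  · rintro ⟨i, -, l, hl, h⟩
    rw [← hnorm] at h
    refine ⟨_, diagonalEquiv_cycMul hσn i hl h, ?_⟩
    ext k
    by_cases hk : (k : ℕ) = 0 <;> simp [diagonalEquiv, cycOne, partialNorm, hk]
end
end

section
/- Let A = (L/F, σ, a) be a nonassociative cyclic algebra of degree n. (1) For every l ∈ L with N_{L/F}(l) = 1, the map sending Σ_{i=0}^{n−1} x_i z^i to Σ_{i=0}^{n−1} x_i · l σ(l) ⋯ σ^{i−1}(l) · z^i is an F-algebra automorphism of A. (2) Every F-algebra automorphism of A is of the form Σ_{i=0}^{n−1} x_i z^i ↦ Σ_{i=0}^{n−1} σ^j(x_i) · l σ(l) ⋯ σ^{i−1}(l) · z^i for some integer 0 ≤ j < n and some l ∈ L^× satisfying σ^j(a) = N_{L/F}(l) · a. -/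
noncomputable section

/-- The twisted power `l σ(l) ⋯ σ^{i-1}(l)`. -/
abbrev twistedPow {F L : Type*} [Field F] [Field L] [Algebra F L]
    (σ : L ≃ₐ[F] L) (l : L) (i : ℕ) : L :=
  ∏ t ∈ Finset.range i, (σ ^ t) l

section twistedPow

variable {F L : Type*} [Field F] [Field L] [Algebra F L] (σ : L ≃ₐ[F] L) (l : L)

theorem twistedPow_add (i j : ℕ) :
    twistedPow σ l (i + j) = twistedPow σ l i * (σ ^ i) (twistedPow σ l j) := by
  simp only [twistedPow, Finset.prod_range_add, map_prod, pow_add, AlgEquiv.mul_apply]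

theorem twistedPow_ne_zero (hl : l ≠ 0) (i : ℕ) : twistedPow σ l i ≠ 0 :=
  Finset.prod_ne_zero_iff.mpr fun t _ => (map_ne_zero (σ ^ t)).mpr hl

theorem twistedPow_orderOf [FiniteDimensional F L] [IsGalois F L]
    (hσ : ∀ τ : L ≃ₐ[F] L, τ ∈ Subgroup.zpowers σ) :
    twistedPow σ l (orderOf σ) = algebraMap F L (Algebra.norm F l) := by
  classical
  rw [Algebra.norm_eq_prod_automorphisms, ← IsCyclic.image_range_orderOf hσ,
    Finset.prod_image]
  intro i hi j hj h
  exact pow_injOn_Iio_orderOf (by simpa using hi) (by simpa using hj) h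

end twistedPow

section cycMul

variable {F L : Type*} [Field F] [Field L] [Algebra F L] {n : ℕ} (σ : L ≃ₐ[F] L) (a : L)

theorem cycMul_single_apply_of_add_eq {i j k : Fin n} (h : (i : ℕ) + j = k) (u : L)
    (y : Fin n → L) : cycMul n σ a (Pi.single i u) y k = u * (σ ^ (i : ℕ)) (y j) := by
  rw [cycMul, Finset.sum_eq_single i, Finset.sum_eq_single j]
  · simp [h]
  · intro b _ hb
    rw [if_neg (by omega), if_neg (by omega)]
  · simp
  · intro b _ hb
    simp [Pi.single_eq_of_ne hb]
  · simp

theorem cycMul_single_apply_of_add_eq_add {i j k : Fin n} (h : (i : ℕ) + j = k + n) (u : L)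
    (y : Fin n → L) : cycMul n σ a (Pi.single i u) y k = u * (σ ^ (i : ℕ)) (y j) * a := by
  rw [cycMul, Finset.sum_eq_single i, Finset.sum_eq_single j]
  · rw [if_neg (by omega), if_pos h, Pi.single_eq_same]
  · intro b _ hb
    rw [if_neg (by omega), if_neg (by omega)]
  · simp
  · intro b _ hb
    simp [Pi.single_eq_of_ne hb]
  · simp

theorem cycMul_single_single_of_add_eq {i j k : Fin n} (h : (i : ℕ) + j = k) (u v : L) :
    cycMul n σ a (Pi.single i u) (Pi.single j v) = Pi.single k (u * (σ ^ (i : ℕ)) v) := by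
  ext m
  by_cases hm : m = k
  · subst hm
    simp [cycMul_single_apply_of_add_eq σ a h]
  rw [Pi.single_eq_of_ne hm, cycMul]
  refine Finset.sum_eq_zero fun p _ => Finset.sum_eq_zero fun q _ => ?_
  by_cases hp : p = i
  · by_cases hq : q = j
    · subst hp hq
      rw [if_neg (by omega), if_neg (by omega)]
    · simp [Pi.single_eq_of_ne hq]
  · simp [Pi.single_eq_of_ne hp]

theorem cycMul_single_single_of_add_eq_add {i j k : Fin n} (h : (i : ℕ) + j = k + n) (u v : L) :
    cycMul n σ a (Pi.single i u) (Pi.single j v) = Pi.single k (u * (σ ^ (i : ℕ)) v * a) := by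
  ext m
  by_cases hm : m = k
  · subst hm
    simp [cycMul_single_apply_of_add_eq_add σ a h]
  rw [Pi.single_eq_of_ne hm, cycMul]
  refine Finset.sum_eq_zero fun p _ => Finset.sum_eq_zero fun q _ => ?_
  by_cases hp : p = i
  · by_cases hq : q = j
    · subst hp hq
      rw [if_neg (by omega), if_neg (by omega)]
    · simp [Pi.single_eq_of_ne hq]
  · simp [Pi.single_eq_of_ne hp]

variable [NeZero n]

theorem cycOne_eq_single : cycOne L n = Pi.single 0 1 := by
  ext k
  simp [cycOne, Pi.single_apply, Fin.val_eq_zero_iff]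

theorem cycMul_single_zero_left (u : L) (y : Fin n → L) (k : Fin n) :
    cycMul n σ a (Pi.single 0 u) y k = u * y k := by
  simpa using cycMul_single_apply_of_add_eq σ a (i := 0) (j := k) (k := k) (by simp) u y

theorem cycMul_single_zero_right (x : Fin n → L) (l : L) (k : Fin n) :
    cycMul n σ a x (Pi.single 0 l) k = x k * (σ ^ (k : ℕ)) l := by
  rw [cycMul, Finset.sum_eq_single k, Finset.sum_eq_single 0]
  · simp
  · intro b _ hb
    simp [Pi.single_eq_of_ne hb]
  · simp
  · intro b _ hb
    refine Finset.sum_eq_zero fun q _ => ?_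
    by_cases hq : q = 0
    · subst hq
      rw [if_neg (by simpa [Fin.ext_iff] using hb), if_neg (by simp; omega)]
    · simp [Pi.single_eq_of_ne hq]
  · simp

/-- `L` is contained in the right nucleus. -/
theorem cycMul_assoc_single_zero (hord : orderOf σ = n) (x y : Fin n → L) (l : L) :
    cycMul n σ a (cycMul n σ a x y) (Pi.single 0 l) =
      cycMul n σ a x (cycMul n σ a y (Pi.single 0 l)) := by
  have hpow : σ ^ n = 1 := hord ▸ pow_orderOf_eq_one σ
  ext k
  rw [cycMul_single_zero_right]
  simp only [cycMul.eq_def n σ a x, cycMul_single_zero_right, Finset.sum_mul]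
  refine Finset.sum_congr rfl fun i _ => Finset.sum_congr rfl fun j _ => ?_
  split_ifs with h₁ h₂
  · simp only [← h₁, map_mul, pow_add, AlgEquiv.mul_apply, mul_assoc]
  · have : σ ^ (k : ℕ) = σ ^ (i : ℕ) * σ ^ (j : ℕ) := by
      rw [← pow_add, h₂, pow_add, hpow, mul_one]
    simp only [this, map_mul, AlgEquiv.mul_apply]
    ring
  · simp

/-- An element `w` satisfying `(z z^{n-1}) w = z (z^{n-1} w)` lies in `L`. -/
theorem eq_single_zero_of_assoc (hn : 2 ≤ n) (hord : orderOf σ = n) (ha : σ a ≠ a)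
    (w : Fin n → L)
    (hw : cycMul n σ a (cycMul n σ a (Pi.single ⟨1, hn⟩ 1)
        (Pi.single ⟨n - 1, by omega⟩ 1)) w =
      cycMul n σ a (Pi.single ⟨1, hn⟩ 1)
        (cycMul n σ a (Pi.single ⟨n - 1, by omega⟩ 1) w)) :
    w = Pi.single 0 (w 0) := by
  have hpow : σ ^ n = 1 := hord ▸ pow_orderOf_eq_one σ
  ext k
  by_cases hk : k = 0
  · subst hk; simp
  have hk' : (k : ℕ) ≠ 0 := mt Fin.val_eq_zero_iff.mp hk
  rw [Pi.single_eq_of_ne hk]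
  have h := congrFun hw k
  rw [cycMul_single_single_of_add_eq_add σ a (k := 0) (by simp; omega),
    cycMul_single_zero_left,
    cycMul_single_apply_of_add_eq σ a (j := ⟨k - 1, by omega⟩) (by simp; omega),
    cycMul_single_apply_of_add_eq_add σ a (j := k) (by simp; omega)] at h
  have hσ : σ ((σ ^ (n - 1)) (w k)) = w k := by
    rw [← AlgEquiv.mul_apply, ← pow_succ', Nat.sub_add_cancel (by omega), hpow,
      AlgEquiv.one_apply]
  simp only [map_one, one_mul, pow_one, map_mul, hσ] at h
  by_contra hne
  exact ha (mul_left_cancel₀ hne (by rw [← h, mul_comm]))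

end cycMul

section automorphisms

variable {F L : Type*} [Field F] [Field L] [Algebra F L] {n : ℕ} {σ : L ≃ₐ[F] L} {a : L}

/-- Scaling the `i`-th coordinate by the twisted power of a nonzero `l`. -/
def twistedScale (n : ℕ) (σ : L ≃ₐ[F] L) (l : L) (hl : l ≠ 0) :
    (Fin n → L) ≃ₗ[F] (Fin n → L) where
  toFun x i := x i * twistedPow σ l i
  invFun x i := x i / twistedPow σ l i
  map_add' x y := by ext i; simp [add_mul]
  map_smul' c x := by ext i; simp
  left_inv x := by ext i; simp [twistedPow_ne_zero σ l hl]
  right_inv x := by ext i; simp [twistedPow_ne_zero σ l hl]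

theorem twistedScale_apply (l : L) (hl : l ≠ 0) (x : Fin n → L) (i : Fin n) :
    twistedScale n σ l hl x i = x i * twistedPow σ l i :=
  rfl

theorem twistedScale_cycMul (l : L) (hl : l ≠ 0) (hord : orderOf σ = n)
    (hP : twistedPow σ l n = 1)
    (x y : Fin n → L) :
    twistedScale n σ l hl (cycMul n σ a x y) =
      cycMul n σ a (twistedScale n σ l hl x) (twistedScale n σ l hl y) := by
  ext k
  simp only [twistedScale_apply, cycMul, Finset.sum_mul]
  refine Finset.sum_congr rfl fun i _ => Finset.sum_congr rfl fun j _ => ?_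
  split_ifs with h₁ h₂
  · rw [← h₁, twistedPow_add, map_mul]
    ring
  · have : twistedPow σ l k = twistedPow σ l i * (σ ^ (i : ℕ)) (twistedPow σ l j) := by
      rw [← twistedPow_add, h₂, add_comm, twistedPow_add, hP, one_mul,
        orderOf_dvd_iff_pow_eq_one.mp hord.dvd, AlgEquiv.one_apply]
    rw [this, map_mul]
    ring
  · simp

variable [NeZero n]

theorem map_single_zero (hn : 2 ≤ n) (hord : orderOf σ = n) (ha : σ a ≠ a)
    (e : (Fin n → L) ≃ₗ[F] (Fin n → L))
    (hmul : ∀ x y : Fin n → L, e (cycMul n σ a x y) = cycMul n σ a (e x) (e y)) (x : L) :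
    e (Pi.single 0 x) = Pi.single 0 (e (Pi.single 0 x) 0) := by
  apply eq_single_zero_of_assoc σ a hn hord ha
  obtain ⟨u, hu⟩ := e.surjective (Pi.single ⟨1, hn⟩ 1)
  obtain ⟨v, hv⟩ := e.surjective (Pi.single ⟨n - 1, by omega⟩ 1)
  rw [← hu, ← hv, ← hmul, ← hmul, ← hmul, ← hmul, cycMul_assoc_single_zero σ a hord]

/-- The restriction to `L` of an automorphism of the nonassociative cyclic algebra. -/
def restrictToField (e : (Fin n → L) ≃ₗ[F] (Fin n → L))
    (hmul : ∀ x y : Fin n → L, e (cycMul n σ a x y) = cycMul n σ a (e x) (e y))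
    (hone : e (cycOne L n) = cycOne L n)
    (hL : ∀ x : L, e (Pi.single 0 x) = Pi.single 0 (e (Pi.single 0 x) 0)) : L →ₐ[F] L :=
  AlgHom.ofLinearMap
    (LinearMap.proj 0 ∘ₗ e.toLinearMap ∘ₗ LinearMap.single F (fun _ : Fin n => L) 0)
    (by
      rw [cycOne_eq_single] at hone
      simp [hone])
    (fun x y => by
      have h : (Pi.single 0 (x * y) : Fin n → L) =
          cycMul n σ a (Pi.single 0 x) (Pi.single 0 y) := by
        rw [cycMul_single_single_of_add_eq σ a (k := 0) (by simp)]
        simp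
      simp only [LinearMap.comp_apply, LinearMap.coe_single, LinearMap.proj_apply,
        LinearEquiv.coe_coe, h, hmul]
      rw [hL x, cycMul_single_zero_left, Pi.single_eq_same])

theorem map_single_one (hn : 2 ≤ n) (hord : orderOf σ = n)
    (e : (Fin n → L) ≃ₗ[F] (Fin n → L))
    (hmul : ∀ x y : Fin n → L, e (cycMul n σ a x y) = cycMul n σ a (e x) (e y))
    (j : ℕ) (hj : ∀ x : L, e (Pi.single 0 x) = Pi.single 0 ((σ ^ j) x)) :
    e (Pi.single ⟨1, hn⟩ 1) = Pi.single ⟨1, hn⟩ (e (Pi.single ⟨1, hn⟩ 1) ⟨1, hn⟩) := by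
  ext i
  by_cases hi : i = ⟨1, hn⟩
  · subst hi; simp
  rw [Pi.single_eq_of_ne hi]
  by_contra hne
  have hσi : σ ^ ((i : ℕ) + j) = σ ^ (1 + j) := by
    ext x
    have h : cycMul n σ a (Pi.single ⟨1, hn⟩ 1) (Pi.single 0 x) =
        cycMul n σ a (Pi.single 0 (σ x)) (Pi.single ⟨1, hn⟩ 1) := by
      rw [cycMul_single_single_of_add_eq σ a (k := ⟨1, hn⟩) (by simp),
        cycMul_single_single_of_add_eq σ a (k := ⟨1, hn⟩) (by simp)]
      simp
    have h' := congrFun (congrArg e h) i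
    rw [hmul, hmul, hj, hj, cycMul_single_zero_left, cycMul_single_zero_right,
      mul_comm] at h'
    have h'' := mul_right_cancel₀ hne h'
    rw [pow_add, AlgEquiv.mul_apply, h'', add_comm 1 j, pow_succ, AlgEquiv.mul_apply]
  rw [pow_add, pow_add, mul_left_inj] at hσi
  have := pow_injOn_Iio_orderOf (x := σ) (by simp [hord]) (by simp [hord]; omega) hσi
  exact hi (Fin.ext this)

theorem map_single_of_pow (hn : 2 ≤ n)
    (e : (Fin n → L) ≃ₗ[F] (Fin n → L))
    (hmul : ∀ x y : Fin n → L, e (cycMul n σ a x y) = cycMul n σ a (e x) (e y))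
    (hone : e (cycOne L n) = cycOne L n)
    (l : L) (hl : e (Pi.single ⟨1, hn⟩ 1) = Pi.single ⟨1, hn⟩ l) (i : ℕ) (hi : i < n) :
    e (Pi.single ⟨i, hi⟩ 1) = Pi.single ⟨i, hi⟩ (twistedPow σ l i) := by
  induction i with
  | zero =>
    rw [cycOne_eq_single] at hone
    simpa [twistedPow] using hone
  | succ i ih =>
    have h : (Pi.single ⟨i + 1, hi⟩ 1 : Fin n → L) =
        cycMul n σ a (Pi.single ⟨1, hn⟩ 1) (Pi.single ⟨i, by omega⟩ 1) := by
      rw [cycMul_single_single_of_add_eq σ a (k := ⟨i + 1, hi⟩) (by simp [add_comm])]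
      simp
    rw [h, hmul, hl, ih, cycMul_single_single_of_add_eq σ a (k := ⟨i + 1, hi⟩)
      (by simp [add_comm])]
    congr 1
    rw [Nat.add_comm i 1, twistedPow_add]
    simp [twistedPow]

end automorphisms

/-- (1) for each `l ∈ L` with `N_{L/F}(l) = 1` the map
`Σ xᵢ zⁱ ↦ Σ xᵢ · l σ(l) ⋯ σ^{i-1}(l) · zⁱ` is an `F`-algebra automorphism of
`A = (L/F, σ, a)`; (2) every `F`-algebra automorphism of `A` has the form
`Σ xᵢ zⁱ ↦ Σ σʲ(xᵢ) · l σ(l) ⋯ σ^{i-1}(l) · zⁱ` for some `0 ≤ j < n` and `l ∈ Lˣ`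
with `σʲ(a) = N_{L/F}(l) · a`. -/
theorem sandler_automorphisms
    {F L : Type*} [Field F] [Field L] [Algebra F L] [IsGalois F L]
    (n : ℕ) (hn : 2 ≤ n) (hrank : Module.finrank F L = n)
    (σ : L ≃ₐ[F] L) (hσ : ∀ τ : L ≃ₐ[F] L, τ ∈ Subgroup.zpowers σ)
    (a : L) (ha : a ∉ Set.range (algebraMap F L)) :
    (∀ l : L, Algebra.norm F l = 1 →
      ∃ e : (Fin n → L) ≃ₗ[F] (Fin n → L),
        (∀ x y : Fin n → L, e (cycMul n σ a x y) = cycMul n σ a (e x) (e y)) ∧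
        e (cycOne L n) = cycOne L n ∧
        ∀ x : Fin n → L, ∀ i : Fin n,
          e x i = x i * ∏ t ∈ Finset.range (i : ℕ), (σ ^ t) l) ∧
    (∀ e : (Fin n → L) ≃ₗ[F] (Fin n → L),
      (∀ x y : Fin n → L, e (cycMul n σ a x y) = cycMul n σ a (e x) (e y)) →
      e (cycOne L n) = cycOne L n →
      ∃ j : ℕ, j < n ∧ ∃ l : L, l ≠ 0 ∧
        (σ ^ j) a = algebraMap F L (Algebra.norm F l) * a ∧
        ∀ x : Fin n → L, ∀ i : Fin n,
          e x i = (σ ^ j) (x i) * ∏ t ∈ Finset.range (i : ℕ), (σ ^ t) l) := by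
  have hpos : 0 < Module.finrank F L := by omega
  have : FiniteDimensional F L := FiniteDimensional.of_finrank_pos hpos
  have : NeZero n := ⟨by omega⟩
  have hord : orderOf σ = n := by
    rw [orderOf_eq_card_of_forall_mem_zpowers hσ, IsGalois.card_aut_eq_finrank, hrank]
  have hσa : σ a ≠ a := by
    intro h
    refine ha ((IsGalois.mem_range_algebraMap_iff_fixed a).mpr fun τ => ?_)
    exact (Subgroup.zpowers_le (H := MulAction.stabilizer (L ≃ₐ[F] L) a)).mpr h (hσ τ)
  have hnorm (l : L) : twistedPow σ l n = algebraMap F L (Algebra.norm F l) :=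
    hord ▸ twistedPow_orderOf σ l hσ
  refine ⟨fun l hl => ?_, fun e hmul hone => ?_⟩
  · have hl0 : l ≠ 0 := by
      rintro rfl
      simp [Algebra.norm_zero] at hl
    refine ⟨twistedScale n σ l hl0,
      twistedScale_cycMul l hl0 hord (by rw [hnorm, hl, map_one]), ?_, fun _ _ => rfl⟩
    ext i
    rw [twistedScale_apply, cycOne]
    split_ifs with hi <;> simp [hi, twistedPow]
  · have hL := map_single_zero hn hord hσa e hmul
    let τ := AlgEquiv.ofBijective (restrictToField e hmul hone hL)
      (AlgHom.bijective _)
    obtain ⟨j, hjn, hj⟩ : ∃ j < n, σ ^ j = τ := by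
      classical
      have := IsCyclic.image_range_orderOf hσ ▸ Finset.mem_univ τ
      simpa [hord] using this
    have hτ (x : L) : e (Pi.single 0 x) = Pi.single 0 ((σ ^ j) x) := by
      rw [hj]
      exact hL x
    have hz := map_single_one hn hord e hmul j hτ
    set l := e (Pi.single ⟨1, hn⟩ 1) ⟨1, hn⟩
    have hpow := map_single_of_pow hn e hmul hone l hz
    refine ⟨j, hjn, l, ?_, ?_, fun x i => ?_⟩
    · intro h0
      rw [h0, Pi.single_zero, LinearEquiv.map_eq_zero_iff, Pi.single_eq_zero_iff] at hz
      exact one_ne_zero hz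
    · have h : (Pi.single 0 a : Fin n → L) =
          cycMul n σ a (Pi.single ⟨1, hn⟩ 1) (Pi.single ⟨n - 1, by omega⟩ 1) := by
        rw [cycMul_single_single_of_add_eq_add σ a (k := 0) (by simp; omega)]
        simp
      have h' := congrFun (congrArg e h) 0
      rw [hτ, hmul, hz, hpow, cycMul_single_single_of_add_eq_add σ a (k := 0)
        (by simp; omega), Pi.single_eq_same, Pi.single_eq_same] at h'
      rw [h', ← hnorm l]
      have hn1 : n = 1 + (n - 1) := by omega
      conv_rhs => rw [hn1, twistedPow_add]
      simp [twistedPow]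
    · have hterm (m : Fin n) :
          e (Pi.single m (x m)) = Pi.single m ((σ ^ j) (x m) * twistedPow σ l m) := by
        have h : (Pi.single m (x m) : Fin n → L) =
            cycMul n σ a (Pi.single 0 (x m)) (Pi.single m 1) := by
          rw [cycMul_single_single_of_add_eq σ a (k := m) (by simp)]
          simp
        rw [h, hmul, hτ, hpow m m.2, cycMul_single_single_of_add_eq σ a (k := m) (by simp)]
        simp only [Fin.val_zero, pow_zero, AlgEquiv.one_apply]
      have hx : e x = fun m => (σ ^ j) (x m) * twistedPow σ l m := by
        conv_lhs => rw [← Finset.univ_sum_single x, map_sum]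
        simp only [hterm]
        exact Finset.univ_sum_single _
      rw [hx]
end
end
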